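/- arXiv:1504.01542 — 8 statements merged into one kernel-verified Lean document; each statement's English description precedes it below -/
import Mathlib

section
/- Let q, p, b, T be real numbers with 0 < q, -q < p, b > 0, T > 0, and fix t ∈ [0,T]. Define f(r) := ((e^{-b(T-r)} - 1)/b)·1_{[t,T]}(r) and m(x) := ∫₀ˣ p·e^{-(p+q)u}·(1 - e^{-b(x-u)}) du. Then ∫₀^∞ ( f(t+s) - ∫₀^∞ p·e^{-(p+q)u}·f(t+s+u) du )² ds = (1/b²)·∫₀^{T-t} ( m(s) + e^{-bs} - 1 )² ds. -/
/-- Integrating a weight against a shifted function supported on `[t, T]` only involves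
the shifts in `(0, T - t - s]`. -/
theorem integral_Ioi_mul_indicator_Icc (g h : ℝ → ℝ) {t T s : ℝ} (hs : 0 < s) :
    ∫ u in Set.Ioi (0:ℝ), g u * Set.indicator (Set.Icc t T) h (t + s + u) =
      ∫ u in Set.Ioc (0:ℝ) (T - t - s), g u * h (t + s + u) := by
  have hsub : Set.Ioc (0:ℝ) (T - t - s) ⊆ Set.Ioi 0 := fun u hu => hu.1
  rw [← Set.inter_eq_self_of_subset_right hsub, ← MeasureTheory.setIntegral_indicator
    measurableSet_Ioc]
  refine MeasureTheory.setIntegral_congr_fun measurableSet_Ioi fun u hu => ?_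
  have hu : 0 < u := hu
  by_cases hle : u ≤ T - t - s
  · rw [Set.indicator_of_mem (show t + s + u ∈ Set.Icc t T from ⟨by linarith, by linarith⟩),
      Set.indicator_of_mem (show u ∈ Set.Ioc 0 (T - t - s) from ⟨hu, hle⟩)]
  · rw [Set.indicator_of_notMem (fun H => hle (by linarith [H.2])),
      Set.indicator_of_notMem (fun H => hle H.2), mul_zero]


/-- The `n = 0` term of the prediction-error variance:
`∫₀^∞ (f(t+s) - ∫₀^∞ p e^{-(p+q)u} f(t+s+u) du)² ds
  = (1/b²) ∫₀^{T-t} (m(s) + e^{-bs} - 1)² ds`. -/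
theorem d0_square_integral (q p b T : ℝ) (hq : 0 < q) (hp : -q < p)
    (hb : 0 < b) (hT : 0 < T)
    (m : ℝ → ℝ)
    (hm : ∀ x : ℝ, m x =
      ∫ u in (0:ℝ)..x, p * Real.exp (-(p + q) * u) * (1 - Real.exp (-b * (x - u))))
    (t : ℝ) (ht : 0 ≤ t) (htT : t ≤ T)
    (f : ℝ → ℝ)
    (hf : ∀ r : ℝ,
      f r = Set.indicator (Set.Icc t T) (fun r' => (Real.exp (-b * (T - r')) - 1) / b) r) :
    (∫ s in Set.Ioi (0:ℝ),
        (f (t + s) - ∫ u in Set.Ioi (0:ℝ), p * Real.exp (-(p + q) * u) * f (t + s + u)) ^ 2)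
      = (1 / b ^ 2) * ∫ s in (0:ℝ)..(T - t), (m s + Real.exp (-b * s) - 1) ^ 2 := by
  set I := T - t with hI
  have hI0 : 0 ≤ I := by linarith
  obtain rfl : f = _ := funext hf
  have hsub : Set.Ioc (0:ℝ) I ⊆ Set.Ioi 0 := fun s hs => hs.1
  have key : ∀ s ∈ Set.Ioi (0:ℝ),
      (Set.indicator (Set.Icc t T) (fun r' => (Real.exp (-b * (T - r')) - 1) / b) (t + s) -
        ∫ u in Set.Ioi (0:ℝ), p * Real.exp (-(p + q) * u) * Set.indicator (Set.Icc t T)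
          (fun r' => (Real.exp (-b * (T - r')) - 1) / b) (t + s + u)) ^ 2 =
      Set.indicator (Set.Ioc 0 I)
        (fun s => 1 / b ^ 2 * (m (I - s) + Real.exp (-b * (I - s)) - 1) ^ 2) s := by
    intro s hs
    have hs : 0 < s := hs
    rw [integral_Ioi_mul_indicator_Icc (fun u => p * Real.exp (-(p + q) * u)) _ hs, ← hI]
    by_cases hle : s ≤ I
    · rw [Set.indicator_of_mem (show t + s ∈ Set.Icc t T from ⟨by linarith, by linarith⟩),
        Set.indicator_of_mem (show s ∈ Set.Ioc 0 I from ⟨hs, hle⟩),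
        ← intervalIntegral.integral_of_le (by linarith)]
      have hconv : (∫ u in (0:ℝ)..(I - s), p * Real.exp (-(p + q) * u) *
          ((Real.exp (-b * (T - (t + s + u))) - 1) / b)) = -(1 / b) * m (I - s) := by
        rw [hm, ← intervalIntegral.integral_const_mul]
        congr 1 with u
        rw [show T - (t + s + u) = I - s - u by rw [hI]; ring]
        ring
      rw [hconv, show T - (t + s) = I - s by rw [hI]; ring]
      ring
    · rw [Set.indicator_of_notMem (fun H => hle (by linarith [H.2])),
        Set.indicator_of_notMem (fun H => hle H.2), Set.Ioc_eq_empty (by linarith)]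
      simp
  rw [MeasureTheory.setIntegral_congr_fun measurableSet_Ioi key,
    MeasureTheory.setIntegral_indicator measurableSet_Ioc,
    Set.inter_eq_self_of_subset_right hsub, ← intervalIntegral.integral_of_le hI0,
    intervalIntegral.integral_comp_sub_left
      (fun x => 1 / b ^ 2 * (m x + Real.exp (-b * x) - 1) ^ 2),
    intervalIntegral.integral_const_mul, sub_self, sub_zero]
end

section
/- Let q, p, b, T be real numbers with 0 < q, -q < p, b > 0, T > 0, and fix t ∈ [0,T], s ≥ 0 and an integer n ≥ 1. With φ(t) := -p·e^{-qt}/(p+2q), bₙ(r,τ) := -φ(t)^{n-1}·p·e^{-qr}·e^{-(p+q)τ}, and m(x) := ∫₀ˣ p·e^{-(p+q)u}·(1 - e^{-b(x-u)}) du, one has -∫₀^∞ p·e^{-(p+q)u}·( ∫₀^{T-t} bₙ(t+u+s,τ)·(e^{-b(T-t-τ)} - 1)/b dτ ) du + ∫₀^{T-t} bₙ(t+s,τ)·(e^{-b(T-t-τ)} - 1)/b dτ = (2q·e^{-q(t+s)}/(b·(p+2q)))·m(T-t)·φ(t)^{n-1}. -/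
/-- Computation of `dₙ(s,f)` for `n ≥ 1`: with `bₙ(r,τ) = -φ(t)^{n-1} p e^{-qr} e^{-(p+q)τ}`,
`-∫₀^∞ p e^{-(p+q)u} (∫₀^{T-t} bₙ(t+u+s,τ)(e^{-b(T-t-τ)}-1)/b dτ) du
  + ∫₀^{T-t} bₙ(t+s,τ)(e^{-b(T-t-τ)}-1)/b dτ
  = (2q e^{-q(t+s)}/(b(p+2q))) m(T-t) φ(t)^{n-1}`. -/
theorem dn_formula (q p b T : ℝ) (hq : 0 < q) (hp : -q < p)
    (hb : 0 < b) (hT : 0 < T)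
    (m : ℝ → ℝ)
    (hm : ∀ x : ℝ, m x =
      ∫ u in (0:ℝ)..x, p * Real.exp (-(p + q) * u) * (1 - Real.exp (-b * (x - u))))
    (φ : ℝ → ℝ) (hφ : ∀ t' : ℝ, φ t' = -(p * Real.exp (-q * t')) / (p + 2 * q))
    (t : ℝ) (ht : 0 ≤ t) (htT : t ≤ T) (s : ℝ) (hs : 0 ≤ s)
    (n : ℕ) (hn : 1 ≤ n)
    (bn : ℝ → ℝ → ℝ)
    (hbn : ∀ r τ : ℝ,
      bn r τ = -(φ t ^ (n - 1) * p * Real.exp (-q * r) * Real.exp (-(p + q) * τ))) :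
    -(∫ u in Set.Ioi (0:ℝ), p * Real.exp (-(p + q) * u) *
        (∫ τ in (0:ℝ)..(T - t), bn (t + u + s) τ * ((Real.exp (-b * (T - t - τ)) - 1) / b)))
      + (∫ τ in (0:ℝ)..(T - t), bn (t + s) τ * ((Real.exp (-b * (T - t - τ)) - 1) / b))
      = 2 * q * Real.exp (-q * (t + s)) / (b * (p + 2 * q)) * m (T - t) * φ t ^ (n - 1) := by
  have hpos : 0 < p + 2 * q := by linarith
  have inner_eq : ∀ r : ℝ,
      (∫ τ in (0:ℝ)..(T - t), bn r τ * ((Real.exp (-b * (T - t - τ)) - 1) / b))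
        = φ t ^ (n - 1) * m (T - t) / b * Real.exp (-q * r) := by
    intro r
    calc
      _ = ∫ τ in (0:ℝ)..(T - t), φ t ^ (n - 1) * Real.exp (-q * r) / b *
            (p * Real.exp (-(p + q) * τ) * (1 - Real.exp (-b * (T - t - τ)))) := by
        congr 1 with τ
        rw [hbn]
        ring
      _ = _ := by
        rw [intervalIntegral.integral_const_mul, ← hm]
        ring
  have outer_integrand : ∀ u : ℝ,
      p * Real.exp (-(p + q) * u) *
          (φ t ^ (n - 1) * m (T - t) / b * Real.exp (-q * (t + u + s)))
        = p * (φ t ^ (n - 1) * m (T - t) / b * Real.exp (-q * (t + s))) *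
          Real.exp (-(p + 2 * q) * u) := by
    intro u
    have hexp : Real.exp (-(p + q) * u) * Real.exp (-q * (t + u + s))
        = Real.exp (-q * (t + s)) * Real.exp (-(p + 2 * q) * u) := by
      rw [← Real.exp_add, ← Real.exp_add]
      ring_nf
    linear_combination p * (φ t ^ (n - 1) * m (T - t) / b) * hexp
  simp only [inner_eq, outer_integrand]
  rw [MeasureTheory.integral_const_mul,
    integral_exp_mul_Ioi (neg_lt_zero.mpr hpos) 0, mul_zero, Real.exp_zero, neg_div_neg_eq]
  have hfrac : 1 - p * (1 / (p + 2 * q)) = 2 * q / (p + 2 * q) := by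
    rw [mul_one_div, one_sub_div hpos.ne', add_sub_cancel_left]
  rw [div_mul_eq_div_div]
  linear_combination φ t ^ (n - 1) * m (T - t) / b * Real.exp (-q * (t + s)) * hfrac
end

section
/- Let q, p be real numbers with 0 < q and -q < p, and let l(s) := 1 - 2qp/((p+2q)²·e^{2qs} - p²). Then for every s ≥ 0, (p/(p+2q))·( (d/ds)(e^{-(p+2q)s}/l(s)) + p·e^{-(p+2q)s} ) = (d/ds)(e^{-ps}/l(s)) + p·e^{-ps}. Equivalently, the function R(s) := (p/(p+2q))·( (e^{-(p+2q)s}/l(s))' + p·e^{-(p+2q)s} ) - (e^{-ps}/l(s))' - p·e^{-ps} vanishes identically on [0,∞). -/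
open Filter Topology in
/-- If `p / a * f - g` agrees near `s` with `p² / a² * e^{-a x} - e^{-p x}`, then the
remainder built from `f` and `g` vanishes at `s`. -/
theorem remainder_eq_of_eventuallyEq {f g : ℝ → ℝ} {a p s : ℝ} (ha : a ≠ 0)
    (hf : DifferentiableAt ℝ f s) (hg : DifferentiableAt ℝ g s)
    (h : (fun x => p / a * f x - g x) =ᶠ[𝓝 s]
      fun x => p ^ 2 / a ^ 2 * Real.exp (-a * x) - Real.exp (-p * x)) :
    p / a * (deriv f s + p * Real.exp (-a * s)) = deriv g s + p * Real.exp (-p * s) := by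
  have hexp (c : ℝ) : HasDerivAt (fun x => Real.exp (-c * x)) (Real.exp (-c * s) * -c) s := by
    simpa using ((hasDerivAt_id s).const_mul (-c)).exp
  have hleft := (hf.hasDerivAt.const_mul (p / a)).sub hg.hasDerivAt
  have hright := ((hexp a).const_mul (p ^ 2 / a ^ 2)).sub (hexp p)
  have key := hleft.unique (hright.congr_of_eventuallyEq h)
  have hcoeff : p ^ 2 / a ^ 2 * (Real.exp (-a * s) * -a) = -(p / a * (p * Real.exp (-a * s))) := by
    field_simp
  linear_combination key + hcoeff

/-- Vanishing of the remainder term `R(s)`: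
`(p/(p+2q)) ((e^{-(p+2q)s}/l(s))' + p e^{-(p+2q)s}) = (e^{-ps}/l(s))' + p e^{-ps}`
for `l(s) = 1 - 2qp/((p+2q)² e^{2qs} - p²)`. -/
theorem R_vanishes (q p : ℝ) (hq : 0 < q) (hp : -q < p)
    (l : ℝ → ℝ)
    (hl : ∀ s : ℝ, l s = 1 - 2 * q * p / ((p + 2 * q) ^ 2 * Real.exp (2 * q * s) - p ^ 2)) :
    ∀ s : ℝ, 0 ≤ s →
      p / (p + 2 * q) *
          (deriv (fun x => Real.exp (-(p + 2 * q) * x) / l x) s + p * Real.exp (-(p + 2 * q) * s))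
        = deriv (fun x => Real.exp (-p * x) / l x) s + p * Real.exp (-p * s) := by
  intro s hs
  have ha : 0 < p + 2 * q := by linarith
  have hE : 1 ≤ Real.exp (2 * q * s) := Real.one_le_exp (by positivity)
  have hD : 0 < (p + 2 * q) ^ 2 * Real.exp (2 * q * s) - p ^ 2 := by
    nlinarith [mul_le_mul_of_nonneg_left hE (sq_nonneg (p + 2 * q)),
      mul_pos hq (by linarith : 0 < p + q)]
  have hN : 0 < (p + 2 * q) * Real.exp (2 * q * s) - p := by
    nlinarith [mul_le_mul_of_nonneg_left hE ha.le]
  have hl_eq (x : ℝ) (hx : 0 < (p + 2 * q) ^ 2 * Real.exp (2 * q * x) - p ^ 2) :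
      l x = (p + 2 * q) * ((p + 2 * q) * Real.exp (2 * q * x) - p) /
        ((p + 2 * q) ^ 2 * Real.exp (2 * q * x) - p ^ 2) := by
    rw [hl, eq_div_iff hx.ne', sub_mul, div_mul_cancel₀ _ hx.ne']
    ring
  have hls : l s ≠ 0 := by
    rw [hl_eq s hD]
    positivity
  have hld : DifferentiableAt ℝ l s := by
    rw [funext hl]
    exact (differentiableAt_const _).sub
      ((differentiableAt_const _).div (by fun_prop) hD.ne')
  have hexp (c : ℝ) : DifferentiableAt ℝ (fun x => Real.exp (c * x)) s := by fun_prop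
  refine remainder_eq_of_eventuallyEq ha.ne' ((hexp _).div hld hls) ((hexp _).div hld hls) ?_
  have hDc : Continuous fun x => (p + 2 * q) ^ 2 * Real.exp (2 * q * x) - p ^ 2 := by fun_prop
  have hNc : Continuous fun x => (p + 2 * q) * Real.exp (2 * q * x) - p := by fun_prop
  filter_upwards [hDc.continuousAt.eventually (lt_mem_nhds hD),
    hNc.continuousAt.eventually (lt_mem_nhds hN)] with x hDx hNx
  have hsplit : Real.exp (-p * x) = Real.exp (-(p + 2 * q) * x) * Real.exp (2 * q * x) := by
    rw [← Real.exp_add]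
    ring_nf
  rw [hl_eq x hDx, hsplit]
  have hDx' := hDx.ne'
  have hNx' := hNx.ne'
  generalize Real.exp (2 * q * x) = E at *
  generalize p + 2 * q = a at *
  field_simp
  ring
end

section
/- Let q, p be real numbers with 0 < q and -q < p, let l(s) := 1 - 2qp/((p+2q)²·e^{2qs} - p²), and let u : [0,∞) → ℝ be continuously differentiable with u(0) = 0. Then for every t ≥ 0, ∫₀ᵗ ( e^{qs} - (p/(p+2q))·e^{-qs} ) · ( (e^{-(p+q)s}/l(s))·u'(s) - p·e^{-(p+q)s}·u(s) ) ds = (e^{-pt}/l(t)) · ( 1 - (p/(p+2q))·e^{-2qt} ) · u(t). -/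
/-- The factor multiplying `u` on the right-hand side is a combination of two exponentials. -/
lemma exp_mul_inv_factor_eq {q p s L : ℝ} (hq : 0 < q) (hp : -q < p) (hs : 0 ≤ s)
    (hL : L = 1 - 2 * q * p / ((p + 2 * q) ^ 2 * Real.exp (2 * q * s) - p ^ 2)) :
    (Real.exp (-p * s) / L) * (1 - p / (p + 2 * q) * Real.exp (-2 * q * s)) =
      Real.exp (-p * s) - (p / (p + 2 * q)) ^ 2 * Real.exp (-(p + 2 * q) * s) := by
  have ha : 0 < p + 2 * q := by linarith
  have hx : 1 ≤ Real.exp (2 * q * s) := Real.one_le_exp (by positivity)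
  have h₁ : Real.exp (-2 * q * s) = (Real.exp (2 * q * s))⁻¹ := by
    rw [← Real.exp_neg]; ring_nf
  have h₂ : Real.exp (-(p + 2 * q) * s) = Real.exp (-p * s) * (Real.exp (2 * q * s))⁻¹ := by
    rw [← Real.exp_neg, ← Real.exp_add]; ring_nf
  rw [h₁, h₂, hL]
  generalize Real.exp (2 * q * s) = x at hx
  have hD : 0 < (p + 2 * q) ^ 2 * x - p ^ 2 := by
    nlinarith [mul_nonneg (sq_nonneg (p + 2 * q)) (sub_nonneg.2 hx),
      mul_pos hq (neg_lt_iff_pos_add.1 hp)]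
  have hN : 0 < (p + 2 * q) * x - p := by
    nlinarith [mul_nonneg ha.le (sub_nonneg.2 hx)]
  have hl : 1 - 2 * q * p / ((p + 2 * q) ^ 2 * x - p ^ 2) =
      (p + 2 * q) * ((p + 2 * q) * x - p) / ((p + 2 * q) ^ 2 * x - p ^ 2) := by
    field_simp
    ring
  have hx0 : x ≠ 0 := by positivity
  rw [hl]
  field_simp

/-- Pathwise content of Lemma 5.1: for continuously differentiable `u` with `u(0) = 0`,
`∫₀ᵗ (e^{qs} - (p/(p+2q)) e^{-qs}) ((e^{-(p+q)s}/l(s)) u'(s) - p e^{-(p+q)s} u(s)) ds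
  = (e^{-pt}/l(t)) (1 - (p/(p+2q)) e^{-2qt}) u(t)`. -/
theorem lemma51_pathwise (q p : ℝ) (hq : 0 < q) (hp : -q < p)
    (l : ℝ → ℝ)
    (hl : ∀ s : ℝ, l s = 1 - 2 * q * p / ((p + 2 * q) ^ 2 * Real.exp (2 * q * s) - p ^ 2))
    (u : ℝ → ℝ) (hu : ContDiff ℝ 1 u) (hu0 : u 0 = 0) :
    ∀ t : ℝ, 0 ≤ t →
      (∫ s in (0:ℝ)..t,
          (Real.exp (q * s) - p / (p + 2 * q) * Real.exp (-q * s)) *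
            ((Real.exp (-(p + q) * s) / l s) * deriv u s
              - p * Real.exp (-(p + q) * s) * u s))
        = (Real.exp (-p * t) / l t) * (1 - p / (p + 2 * q) * Real.exp (-2 * q * t)) * u t := by
  intro t ht
  have hderiv (s : ℝ) : HasDerivAt
      (fun s => (Real.exp (-p * s) - (p / (p + 2 * q)) ^ 2 * Real.exp (-(p + 2 * q) * s)) * u s)
      ((Real.exp (-p * s) * -p -
          (p / (p + 2 * q)) ^ 2 * (Real.exp (-(p + 2 * q) * s) * -(p + 2 * q))) * u s +
        (Real.exp (-p * s) - (p / (p + 2 * q)) ^ 2 * Real.exp (-(p + 2 * q) * s)) *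
          deriv u s) s := by
    have hexp (c : ℝ) : HasDerivAt (fun s => Real.exp (c * s)) (Real.exp (c * s) * c) s := by
      simpa using ((hasDerivAt_id s).const_mul c).exp
    exact ((hexp _).sub ((hexp _).const_mul _)).mul
      (hu.differentiable one_ne_zero s).hasDerivAt
  have hcont := hu.continuous
  have hcont' := hu.continuous_deriv le_rfl
  rw [exp_mul_inv_factor_eq hq hp ht (hl t)]
  have key := intervalIntegral.integral_eq_sub_of_hasDerivAt (a := 0) (b := t)
    (fun s _ => hderiv s) (Continuous.intervalIntegrable (by fun_prop) _ _)
  rw [hu0, mul_zero, sub_zero] at key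
  rw [← key]
  refine intervalIntegral.integral_congr fun s hs => ?_
  rw [Set.uIcc_of_le ht] at hs
  have ha : p + 2 * q ≠ 0 := by linarith
  have h₁ : Real.exp (q * s) * Real.exp (-(p + q) * s) = Real.exp (-p * s) := by
    rw [← Real.exp_add]; ring_nf
  have h₂ : Real.exp (-q * s) * Real.exp (-(p + q) * s) = Real.exp (-(p + 2 * q) * s) := by
    rw [← Real.exp_add]; ring_nf
  have h₃ : Real.exp (-p * s) * Real.exp (-2 * q * s) = Real.exp (-(p + 2 * q) * s) := by
    rw [← Real.exp_add]; ring_nf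
  have h₄ : (p / (p + 2 * q)) ^ 2 * (p + 2 * q) = p * (p / (p + 2 * q)) := by
    field_simp
  rw [← exp_mul_inv_factor_eq hq hp hs.1 (hl s)]
  linear_combination (deriv u s / l s - p * u s) * h₁ -
    (p / (p + 2 * q)) * (deriv u s / l s - p * u s) * h₂ +
    (p / (p + 2 * q)) * (deriv u s / l s) * h₃ -
    Real.exp (-(p + 2 * q) * s) * u s * h₄
end

section
/- Let a, b, σ be real numbers with b > 0, let z : [0,∞) → ℝ be continuous with z(0) = 0, and let r : [0,∞) → ℝ be a continuous function satisfying the integral equation r(t) = r(0) + ∫₀ᵗ (a - b·r(s)) ds + σ·z(t) for all t ≥ 0. Then for all 0 ≤ t ≤ τ, r(τ) = e^{-b(τ-t)}·r(t) + (a/b)·(1 - e^{-b(τ-t)}) + σ·( z(τ) - e^{-b(τ-t)}·z(t) - b·∫ₜ^τ e^{-b(τ-s)}·z(s) ds ). -/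
/-- Variation of constants for the scalar linear equation `f' = g - b f` with continuous `g`. -/
theorem eq_exp_mul_add_integral_of_hasDerivAt {b t τ : ℝ} {f g : ℝ → ℝ} (hg : Continuous g)
    (hf : ∀ s ∈ Set.uIcc t τ, HasDerivAt f (g s - b * f s) s) :
    f τ = Real.exp (-b * (τ - t)) * f t + ∫ s in t..τ, Real.exp (-b * (τ - s)) * g s := by
  have hderiv : ∀ s ∈ Set.uIcc t τ,
      HasDerivAt (fun s => Real.exp (-b * (τ - s)) * f s) (Real.exp (-b * (τ - s)) * g s) s := by
    intro s hs
    have hexp : HasDerivAt (fun s => Real.exp (-b * (τ - s)))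
        (Real.exp (-b * (τ - s)) * (-b * -1)) s :=
      (((hasDerivAt_id s).const_sub τ).const_mul (-b)).exp
    exact (hexp.mul (hf s hs)).congr_deriv (by ring)
  rw [intervalIntegral.integral_eq_sub_of_hasDerivAt hderiv
    (Continuous.intervalIntegrable (by fun_prop) t τ)]
  simp

/-- Pathwise variation-of-constants formula for the Vasicek-type equation
`dr(t) = (a - b r(t)) dt + σ dZ(t)`: if `r(t) = r(0) + ∫₀ᵗ (a - b r(s)) ds + σ z(t)`,
then `r(τ) = e^{-b(τ-t)} r(t) + (a/b)(1 - e^{-b(τ-t)})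
  + σ (z(τ) - e^{-b(τ-t)} z(t) - b ∫ₜ^τ e^{-b(τ-s)} z(s) ds)`. -/
theorem vasicek_variation_of_constants (a b σ : ℝ) (hb : 0 < b)
    (z : ℝ → ℝ) (hz : Continuous z) (hz0 : z 0 = 0)
    (r : ℝ → ℝ) (hr : Continuous r)
    (heq : ∀ t : ℝ, 0 ≤ t →
      r t = r 0 + (∫ s in (0:ℝ)..t, (a - b * r s)) + σ * z t) :
    ∀ t τ : ℝ, 0 ≤ t → t ≤ τ →
      r τ = Real.exp (-b * (τ - t)) * r t + a / b * (1 - Real.exp (-b * (τ - t)))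
        + σ * (z τ - Real.exp (-b * (τ - t)) * z t
            - b * ∫ s in t..τ, Real.exp (-b * (τ - s)) * z s) := by
  intro t τ ht htτ
  set y : ℝ → ℝ := fun u => r 0 + ∫ s in (0:ℝ)..u, (a - b * r s)
  have hry : ∀ u, 0 ≤ u → r u = y u + σ * z u := heq
  have hy_deriv : ∀ u, HasDerivAt y (a - b * r u) u := fun u =>
    ((Continuous.integral_hasStrictDerivAt (by fun_prop) 0 u).hasDerivAt).const_add (r 0)
  have key := eq_exp_mul_add_integral_of_hasDerivAt (b := b) (t := t) (τ := τ)
    (f := fun u => y u - a / b) (g := fun u => -(b * σ) * z u) (by fun_prop) (by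
      intro s hs
      rw [Set.uIcc_of_le htτ] at hs
      refine ((hy_deriv s).sub_const (a / b)).congr_deriv ?_
      rw [hry s (ht.trans hs.1)]
      field_simp
      ring)
  simp only [mul_left_comm _ (-(b * σ)), intervalIntegral.integral_const_mul] at key
  rw [hry τ (ht.trans htτ), hry t ht]
  linear_combination key
end

section
/- Let q, p, b, σ, T be real numbers with 0 < q, -q < p, b > 0, σ > 0, T > 0. Define m(x) := ∫₀ˣ p·e^{-(p+q)u}·(1 - e^{-b(x-u)}) du, C(t,T) := (1 - e^{-b(T-t)})/b and D(t,T) := (σ/b)·e^{-(p+q)t}·m(T-t). Then for every t ∈ [0,T], the map t ↦ D(t,T) is differentiable and ∂D/∂t (t,T) = -p·σ·e^{-(p+q)t}·C(t,T). -/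
/-- Derivative of `D(t,T) = (σ/b) e^{-(p+q)t} m(T-t)`:
`∂D/∂t = -p σ e^{-(p+q)t} C(t,T)` where `C(t,T) = (1 - e^{-b(T-t)})/b`. -/
theorem D_deriv (q p b σ T : ℝ) (hq : 0 < q) (hp : -q < p)
    (hb : 0 < b) (hσ : 0 < σ) (hT : 0 < T)
    (m : ℝ → ℝ)
    (hm : ∀ x : ℝ, m x =
      ∫ u in (0:ℝ)..x, p * Real.exp (-(p + q) * u) * (1 - Real.exp (-b * (x - u))))
    (C D : ℝ → ℝ)
    (hC : ∀ t : ℝ, C t = (1 - Real.exp (-b * (T - t))) / b)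
    (hD : ∀ t : ℝ, D t = σ / b * Real.exp (-(p + q) * t) * m (T - t)) :
    ∀ t : ℝ, 0 ≤ t → t ≤ T →
      HasDerivAt D (-(p * σ * Real.exp (-(p + q) * t) * C t)) t := by
  have hD' : D = fun t => σ / b * ∫ v in t..T,
      p * Real.exp (-(p + q) * v) * (1 - Real.exp (-b * (T - v))) := by
    funext t
    have hshift := intervalIntegral.integral_comp_add_right (a := 0) (b := T - t)
      (fun v => p * Real.exp (-(p + q) * v) * (1 - Real.exp (-b * (T - v)))) t
    rw [zero_add, sub_add_cancel] at hshift
    rw [hD, hm, ← hshift, mul_assoc, ← intervalIntegral.integral_const_mul]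
    congr 2 with u
    rw [mul_add, Real.exp_add, sub_add_eq_sub_sub_swap]
    ring
  intro t _ _
  have hcont : Continuous fun v : ℝ =>
      p * Real.exp (-(p + q) * v) * (1 - Real.exp (-b * (T - v))) := by fun_prop
  rw [hD', hC]
  refine ((intervalIntegral.integral_hasDerivAt_left (hcont.intervalIntegrable t T)
    (hcont.stronglyMeasurableAtFilter _ _) hcont.continuousAt).const_mul (σ / b)).congr_deriv ?_
  ring
end

section
/- Let q, p, a, b, σ, T be real numbers with 0 < q, -q < p, a > 0, b > 0, σ > 0, T > 0. Define m(x) := ∫₀ˣ p·e^{-(p+q)u}·(1 - e^{-b(x-u)}) du, l(t) := 1 - 2qp/((p+2q)²·e^{2qt} - p²), C(t,T) := (1 - e^{-b(T-t)})/b, v(t,T) := (σ/b)·( e^{-b(T-t)} - 1 + l(t)·m(T-t) ), and A(t,T) := (a/b)·(T - t - C(t,T)) - (σ²/(2b²))·∫₀^{T-t} ( m(s) + e^{-bs} - 1 )² ds - σ²·q·m(T-t)²/( b²·((p+2q)²·e^{2qt} - p²) ). Then for every t ∈ [0,T], the map t ↦ A(t,T) is differentiable and ∂A/∂t (t,T)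 = -a·C(t,T) + (1/2)·v(t,T)². -/
/-- The convolution `∫₀ˣ p e^{-ku} (1 - e^{-b(x-u)}) du` solves `y' = -k y + p (1 - e^{-bx})`. -/
theorem hasDerivAt_integral_exp_convolution (p k b x : ℝ) :
    HasDerivAt
      (fun x : ℝ => ∫ u in (0:ℝ)..x, p * Real.exp (-k * u) * (1 - Real.exp (-b * (x - u))))
      (-k * (∫ u in (0:ℝ)..x, p * Real.exp (-k * u) * (1 - Real.exp (-b * (x - u))))
        + p * (1 - Real.exp (-b * x))) x := by
  have reflect : ∀ y : ℝ,
      (∫ u in (0:ℝ)..y, p * Real.exp (-k * u) * (1 - Real.exp (-b * (y - u)))) =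
        Real.exp (-k * y) * ∫ w in (0:ℝ)..y, p * Real.exp (k * w) * (1 - Real.exp (-b * w)) := by
    intro y
    have h := intervalIntegral.integral_comp_sub_left (a := 0) (b := y)
      (fun w => p * Real.exp (-k * (y - w)) * (1 - Real.exp (-b * w))) y
    simp only [sub_sub_cancel, sub_self, sub_zero] at h
    rw [h, ← intervalIntegral.integral_const_mul]
    refine intervalIntegral.integral_congr fun w _ => ?_
    have : Real.exp (-k * (y - w)) = Real.exp (-k * y) * Real.exp (k * w) := by
      rw [← Real.exp_add]; ring_nf
    simp only [this]
    ring
  simp only [reflect]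
  have hcont : Continuous fun w : ℝ => p * Real.exp (k * w) * (1 - Real.exp (-b * w)) := by
    fun_prop
  have hexp : HasDerivAt (fun y : ℝ => Real.exp (-k * y)) (Real.exp (-k * x) * (-k * 1)) x :=
    ((hasDerivAt_id x).const_mul (-k)).exp
  refine (hexp.mul (hcont.integral_hasStrictDerivAt 0 x).hasDerivAt).congr_deriv ?_
  have hinv : Real.exp (-k * x) * Real.exp (k * x) = 1 := by
    rw [← Real.exp_add]; simp
  linear_combination (p * (1 - Real.exp (-b * x))) * hinv

/-- The denominator `(p+2q)² e^{2qt} - p²` is positive for `t ≥ 0`. -/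
theorem sq_mul_exp_sub_sq_pos {p q t : ℝ} (hq : 0 < q) (hp : -q < p) (ht : 0 ≤ t) :
    0 < (p + 2 * q) ^ 2 * Real.exp (2 * q * t) - p ^ 2 := by
  have h1 : 1 ≤ Real.exp (2 * q * t) := Real.one_le_exp (by positivity)
  have h2 : 0 < q * (p + q) := mul_pos hq (by linarith)
  nlinarith [mul_le_mul_of_nonneg_left h1 (sq_nonneg (p + 2 * q))]


/-- Derivative of
`A(t,T) = (a/b)(T - t - C(t,T)) - (σ²/(2b²)) ∫₀^{T-t} (m(s) + e^{-bs} - 1)² ds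
  - σ² q m(T-t)²/(b²((p+2q)² e^{2qt} - p²))`:
`∂A/∂t = -a C(t,T) + (1/2) v(t,T)²`, where `v(t,T) = (σ/b)(e^{-b(T-t)} - 1 + l(t) m(T-t))`. -/
theorem A_deriv (q p a b σ T : ℝ) (hq : 0 < q) (hp : -q < p)
    (ha : 0 < a) (hb : 0 < b) (hσ : 0 < σ) (hT : 0 < T)
    (m : ℝ → ℝ)
    (hm : ∀ x : ℝ, m x =
      ∫ u in (0:ℝ)..x, p * Real.exp (-(p + q) * u) * (1 - Real.exp (-b * (x - u))))
    (l : ℝ → ℝ)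
    (hl : ∀ t : ℝ, l t = 1 - 2 * q * p / ((p + 2 * q) ^ 2 * Real.exp (2 * q * t) - p ^ 2))
    (C v A : ℝ → ℝ)
    (hC : ∀ t : ℝ, C t = (1 - Real.exp (-b * (T - t))) / b)
    (hv : ∀ t : ℝ, v t = σ / b * (Real.exp (-b * (T - t)) - 1 + l t * m (T - t)))
    (hA : ∀ t : ℝ, A t = a / b * (T - t - C t)
      - σ ^ 2 / (2 * b ^ 2) *
          (∫ s in (0:ℝ)..(T - t), (m s + Real.exp (-b * s) - 1) ^ 2)
      - σ ^ 2 * q * (m (T - t)) ^ 2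
          / (b ^ 2 * ((p + 2 * q) ^ 2 * Real.exp (2 * q * t) - p ^ 2))) :
    ∀ t : ℝ, 0 ≤ t → t ≤ T →
      HasDerivAt A (-(a * C t) + 1 / 2 * (v t) ^ 2) t := by
  intro t ht _
  have hD := (sq_mul_exp_sub_sq_pos hq hp ht).ne'
  have hmd : ∀ x, HasDerivAt m (-(p + q) * m x + p * (1 - Real.exp (-b * x))) x := by
    intro x
    have h := hasDerivAt_integral_exp_convolution p (p + q) b x
    rwa [← funext hm, ← hm x] at h
  have hmc : Continuous m := continuous_iff_continuousAt.2 fun x => (hmd x).continuousAt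
  have hsub : HasDerivAt (fun t : ℝ => T - t) (-1) t := (hasDerivAt_id t).const_sub T
  have hE : HasDerivAt (fun t : ℝ => Real.exp (-b * (T - t)))
      (Real.exp (-b * (T - t)) * (-b * -1)) t := (hsub.const_mul (-b)).exp
  have hCd : HasDerivAt C (-(Real.exp (-b * (T - t)) * (-b * -1)) / b) t := by
    rw [funext hC]
    exact (hE.const_sub 1).div_const b
  have hmt : HasDerivAt (fun t : ℝ => m (T - t))
      ((-(p + q) * m (T - t) + p * (1 - Real.exp (-b * (T - t)))) * -1) t :=
    HasDerivAt.comp t (hmd (T - t)) hsub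
  have hcont : Continuous fun s : ℝ => (m s + Real.exp (-b * s) - 1) ^ 2 := by fun_prop
  have hI : HasDerivAt
      (fun t : ℝ => ∫ s in (0:ℝ)..(T - t), (m s + Real.exp (-b * s) - 1) ^ 2)
      ((m (T - t) + Real.exp (-b * (T - t)) - 1) ^ 2 * -1) t :=
    HasDerivAt.comp t (hcont.integral_hasStrictDerivAt 0 (T - t)).hasDerivAt hsub
  have hexp : HasDerivAt (fun t : ℝ => Real.exp (2 * q * t))
      (Real.exp (2 * q * t) * (2 * q * 1)) t := ((hasDerivAt_id t).const_mul (2 * q)).exp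
  have hden := ((hexp.const_mul ((p + 2 * q) ^ 2)).sub_const (p ^ 2)).const_mul (b ^ 2)
  have hfrac := ((hmt.pow 2).const_mul (σ ^ 2 * q)).div hden (mul_ne_zero (by positivity) hD)
  have hfull := (((hsub.sub hCd).const_mul (a / b)).sub
    (hI.const_mul (σ ^ 2 / (2 * b ^ 2)))).sub hfrac
  rw [funext hA]
  refine hfull.congr_deriv ?_
  rw [hv, hl, hC, Pi.pow_apply]
  generalize Real.exp (-b * (T - t)) = E
  generalize m (T - t) = M
  obtain ⟨D, hDdef⟩ : ∃ D, D = (p + 2 * q) ^ 2 * Real.exp (2 * q * t) - p ^ 2 := ⟨_, rfl⟩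
  have hF : (p + 2 * q) ^ 2 * (Real.exp (2 * q * t) * (2 * q * 1)) = 2 * q * (D + p ^ 2) := by
    rw [hDdef]; ring
  rw [hF, ← hDdef]
  rw [← hDdef] at hD
  field_simp
  ring
end

section
/- Let q, p, a, b, σ, T be real numbers with 0 < q, -q < p, a > 0, b > 0, σ > 0, T > 0. Define m(x) := ∫₀ˣ p·e^{-(p+q)u}·(1 - e^{-b(x-u)}) du, l(t) := 1 - 2qp/((p+2q)²·e^{2qt} - p²), C(t,T) := (1 - e^{-b(T-t)})/b, D(t,T) := (σ/b)·e^{-(p+q)t}·m(T-t), A(t,T) := (a/b)·(T - t - C(t,T)) - (σ²/(2b²))·∫₀^{T-t} ( m(s) + e^{-bs} - 1 )² ds - σ²·q·m(T-t)²/( b²·((p+2q)²·e^{2qt} - p²) ), and F(t,x,y) := exp( -A(t,T) - C(t,T)·x + D(t,T)·y ). Then F(T,x,y) = 1 for all (x,y) ∈ ℝ², and for all (t,x,y) ∈ [0,T) × ℝ × ℝ the term-structure partial differential equation holds: ∂F/∂t + (σ²/2)·∂²F/∂x² + σ·e^{(p+q)t}·l(t)·∂²F/∂x∂y + ((e^{(p+q)t}·l(t))²/2)·∂²F/∂y²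 + ( a - b·x - p·σ·e^{-(p+q)t}·y )·∂F/∂x - x·F = 0. -/
theorem hasDerivAt_integral_exp_mul (c x : ℝ) :
    HasDerivAt (fun x : ℝ => ∫ u in (0:ℝ)..x, Real.exp (c * u)) (Real.exp (c * x)) x := by
  have hc : Continuous fun u : ℝ => Real.exp (c * u) := by fun_prop
  exact hc.integral_hasStrictDerivAt 0 x |>.hasDerivAt

theorem mul_integral_exp_mul (c x : ℝ) :
    c * ∫ u in (0:ℝ)..x, Real.exp (c * u) = Real.exp (c * x) - 1 := by
  have hd (u : ℝ) : HasDerivAt (fun u : ℝ => Real.exp (c * u)) (c * Real.exp (c * u)) u := by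
    simpa [mul_comm] using ((hasDerivAt_id u).const_mul c).exp
  have hc : Continuous fun u : ℝ => c * Real.exp (c * u) := by fun_prop
  rw [← intervalIntegral.integral_const_mul,
    intervalIntegral.integral_eq_sub_of_hasDerivAt (fun u _ => hd u) (hc.intervalIntegrable _ _)]
  simp

theorem hasDerivAt_exp_affine (c d x : ℝ) :
    HasDerivAt (fun x : ℝ => Real.exp (c * x + d)) (c * Real.exp (c * x + d)) x := by
  simpa [mul_comm] using (((hasDerivAt_id x).const_mul c).add_const d).exp

/-- The convolution of `u ↦ p e^{-ku}` with `u ↦ 1 - e^{-bu}` solves the linear equation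
`m' = p (1 - e^{-bx}) - k m`. -/
theorem hasDerivAt_memory (p k b x : ℝ) :
    HasDerivAt
      (fun x : ℝ => ∫ u in (0:ℝ)..x, p * Real.exp (-k * u) * (1 - Real.exp (-b * (x - u))))
      (p * (1 - Real.exp (-b * x))
        - k * ∫ u in (0:ℝ)..x, p * Real.exp (-k * u) * (1 - Real.exp (-b * (x - u)))) x := by
  have hm (x : ℝ) :
      ∫ u in (0:ℝ)..x, p * Real.exp (-k * u) * (1 - Real.exp (-b * (x - u)))
        = p * (∫ u in (0:ℝ)..x, Real.exp (-k * u))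
          - p * Real.exp (-b * x) * ∫ u in (0:ℝ)..x, Real.exp ((b - k) * u) := by
    rw [← intervalIntegral.integral_const_mul, ← intervalIntegral.integral_const_mul,
      ← intervalIntegral.integral_sub
        ((by fun_prop : Continuous fun u : ℝ => p * Real.exp (-k * u)).intervalIntegrable _ _)
        ((by fun_prop : Continuous fun u : ℝ =>
          p * Real.exp (-b * x) * Real.exp ((b - k) * u)).intervalIntegrable _ _)]
    refine intervalIntegral.integral_congr fun u _ => ?_
    have he : Real.exp (-b * x) * Real.exp ((b - k) * u)
        = Real.exp (-k * u) * Real.exp (-b * (x - u)) := by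
      rw [← Real.exp_add, ← Real.exp_add]; ring_nf
    linear_combination p * he
  have hE : HasDerivAt (fun x : ℝ => Real.exp (-b * x)) (-b * Real.exp (-b * x)) x := by
    simpa using hasDerivAt_exp_affine (-b) 0 x
  have h := ((hasDerivAt_integral_exp_mul (-k) x).const_mul p).sub
    ((hE.const_mul p).mul (hasDerivAt_integral_exp_mul (b - k) x))
  rw [funext hm, hm x]
  refine h.congr_deriv ?_
  have he : Real.exp (-b * x) * Real.exp ((b - k) * x) = Real.exp (-k * x) := by
    rw [← Real.exp_add]; ring_nf
  linear_combination (-p) * mul_integral_exp_mul (-k) x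
    + p * Real.exp (-b * x) * mul_integral_exp_mul (b - k) x


/-- The affine bond-price function `F(t,x,y) = exp(-A(t,T) - C(t,T)x + D(t,T)y)`
satisfies the terminal condition `F(T,x,y) = 1` and the term-structure PDE
`∂F/∂t + (σ²/2) ∂²F/∂x² + σ e^{(p+q)t} l(t) ∂²F/∂x∂y + ((e^{(p+q)t} l(t))²/2) ∂²F/∂y²
  + (a - bx - pσ e^{-(p+q)t} y) ∂F/∂x - x F = 0` on `[0,T) × ℝ × ℝ`. -/
theorem term_structure_PDE (q p a b σ T : ℝ) (hq : 0 < q) (hp : -q < p)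
    (ha : 0 < a) (hb : 0 < b) (hσ : 0 < σ) (hT : 0 < T)
    (m : ℝ → ℝ)
    (hm : ∀ x : ℝ, m x =
      ∫ u in (0:ℝ)..x, p * Real.exp (-(p + q) * u) * (1 - Real.exp (-b * (x - u))))
    (l : ℝ → ℝ)
    (hl : ∀ t : ℝ, l t = 1 - 2 * q * p / ((p + 2 * q) ^ 2 * Real.exp (2 * q * t) - p ^ 2))
    (C D A : ℝ → ℝ)
    (hC : ∀ t : ℝ, C t = (1 - Real.exp (-b * (T - t))) / b)
    (hD : ∀ t : ℝ, D t = σ / b * Real.exp (-(p + q) * t) * m (T - t))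
    (hA : ∀ t : ℝ, A t = a / b * (T - t - C t)
      - σ ^ 2 / (2 * b ^ 2) *
          (∫ s in (0:ℝ)..(T - t), (m s + Real.exp (-b * s) - 1) ^ 2)
      - σ ^ 2 * q * (m (T - t)) ^ 2
          / (b ^ 2 * ((p + 2 * q) ^ 2 * Real.exp (2 * q * t) - p ^ 2)))
    (F : ℝ → ℝ → ℝ → ℝ)
    (hF : ∀ t x y : ℝ, F t x y = Real.exp (-A t - C t * x + D t * y)) :
    (∀ x y : ℝ, F T x y = 1) ∧
    ∀ t x y : ℝ, 0 ≤ t → t < T →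
      deriv (fun t' => F t' x y) t
        + σ ^ 2 / 2 * deriv (fun x' => deriv (fun x'' => F t x'' y) x') x
        + σ * Real.exp ((p + q) * t) * l t *
            deriv (fun x' => deriv (fun y' => F t x' y') y) x
        + (Real.exp ((p + q) * t) * l t) ^ 2 / 2 *
            deriv (fun y' => deriv (fun y'' => F t x y'') y') y
        + (a - b * x - p * σ * Real.exp (-(p + q) * t) * y) *
            deriv (fun x' => F t x' y) x
        - x * F t x y = 0 := by
  have hm' (x : ℝ) :
      HasDerivAt m (p * (1 - Real.exp (-b * x)) - (p + q) * m x) x := by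
    rw [funext hm]
    exact hasDerivAt_memory p (p + q) b x
  have hmc : Continuous m := continuous_iff_continuousAt.2 fun x => (hm' x).continuousAt
  refine ⟨fun x y => ?_, fun t x y ht _ => ?_⟩
  · have hm0 : m 0 = 0 := by simp [hm]
    simp [hF, hA, hC, hD, hm0]
  have hW : 0 < (p + 2 * q) ^ 2 * Real.exp (2 * q * t) - p ^ 2 := by
    have h1 : 1 ≤ Real.exp (2 * q * t) := Real.one_le_exp (by positivity)
    nlinarith [mul_pos hq (by linarith : 0 < p + q),
      mul_le_mul_of_nonneg_left h1 (sq_nonneg (p + 2 * q))]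
  have hτ : HasDerivAt (fun t : ℝ => T - t) (-1) t := by
    simpa using (hasDerivAt_id t).const_sub T
  have hE : HasDerivAt (fun t : ℝ => Real.exp (-b * (T - t))) (b * Real.exp (-b * (T - t))) t := by
    refine (hτ.const_mul (-b)).exp.congr_deriv ?_
    ring
  have hC' : HasDerivAt C (-Real.exp (-b * (T - t))) t := by
    rw [funext hC]
    refine ((hE.const_sub 1).div_const b).congr_deriv ?_
    field_simp
  have hM : HasDerivAt (fun t : ℝ => m (T - t))
      (-(p * (1 - Real.exp (-b * (T - t))) - (p + q) * m (T - t))) t := by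
    refine ((hm' (T - t)).comp t hτ).congr_deriv ?_
    ring
  have hexp (c : ℝ) : HasDerivAt (fun t : ℝ => Real.exp (c * t)) (c * Real.exp (c * t)) t := by
    simpa using hasDerivAt_exp_affine c 0 t
  have hD' : HasDerivAt D
      (-(σ / b * Real.exp (-(p + q) * t) * (p * (1 - Real.exp (-b * (T - t)))))) t := by
    rw [funext hD]
    refine (((hexp (-(p + q))).const_mul (σ / b)).mul hM).congr_deriv ?_
    ring
  have hI : HasDerivAt
      (fun t : ℝ => ∫ s in (0:ℝ)..(T - t), (m s + Real.exp (-b * s) - 1) ^ 2)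
      (-(m (T - t) + Real.exp (-b * (T - t)) - 1) ^ 2) t := by
    have hc : Continuous fun s : ℝ => (m s + Real.exp (-b * s) - 1) ^ 2 := by fun_prop
    refine ((hc.integral_hasStrictDerivAt 0 (T - t)).hasDerivAt.comp t hτ).congr_deriv ?_
    ring
  have hKD : Real.exp ((p + q) * t) * D t = σ / b * m (T - t) := by
    have hK : Real.exp ((p + q) * t) * Real.exp (-(p + q) * t) = 1 := by
      rw [← Real.exp_add, neg_mul, add_neg_cancel, Real.exp_zero]
    rw [hD]
    linear_combination σ / b * m (T - t) * hK
  have hA' : HasDerivAt A (σ ^ 2 / 2 * C t ^ 2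
      - σ * l t * C t * (Real.exp ((p + q) * t) * D t)
      + l t ^ 2 * (Real.exp ((p + q) * t) * D t) ^ 2 / 2 - a * C t) t := by
    have h := (((hτ.sub hC').const_mul (a / b)).sub (hI.const_mul (σ ^ 2 / (2 * b ^ 2)))).sub
      (((hM.fun_pow 2).const_mul (σ ^ 2 * q)).div
        ((((hexp (2 * q)).const_mul ((p + 2 * q) ^ 2)).sub_const (p ^ 2)).const_mul (b ^ 2))
        (by positivity))
    refine (h.congr_of_eventuallyEq (.of_forall hA)).congr_deriv ?_
    rw [hKD, hl, hC]
    have hX : (p + 2 * q) ^ 2 * (2 * q * Real.exp (2 * q * t))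
        = 2 * q * (((p + 2 * q) ^ 2 * Real.exp (2 * q * t) - p ^ 2) + p ^ 2) := by ring
    rw [hX]
    generalize (p + 2 * q) ^ 2 * Real.exp (2 * q * t) - p ^ 2 = W at hW ⊢
    have hW' := hW.ne'
    field_simp
    ring
  have hFt : HasDerivAt (fun s => F s x y) (F t x y *
      (-(σ ^ 2 / 2 * C t ^ 2 - σ * l t * C t * (Real.exp ((p + q) * t) * D t)
        + l t ^ 2 * (Real.exp ((p + q) * t) * D t) ^ 2 / 2 - a * C t)
        - -Real.exp (-b * (T - t)) * x
        + -(σ / b * Real.exp (-(p + q) * t) * (p * (1 - Real.exp (-b * (T - t))))) * y)) t := by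
    rw [funext fun s => hF s x y, hF]
    exact ((hA'.neg.sub (hC'.mul_const x)).add (hD'.mul_const y)).exp
  have hFx (x y : ℝ) : HasDerivAt (fun x => F t x y) (-C t * F t x y) x := by
    have h (x : ℝ) : F t x y = Real.exp (-C t * x + (-A t + D t * y)) := by
      rw [hF]; ring_nf
    rw [funext h, h x]
    exact hasDerivAt_exp_affine _ _ x
  have hFy (x y : ℝ) : HasDerivAt (fun y => F t x y) (D t * F t x y) y := by
    have h (y : ℝ) : F t x y = Real.exp (D t * y + (-A t - C t * x)) := by
      rw [hF]; ring_nf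
    rw [funext h]
    exact hasDerivAt_exp_affine _ _ y
  simp only [fun x y => (hFx x y).deriv, fun x y => (hFy x y).deriv, hFt.deriv,
    fun c : ℝ => ((hFx x y).const_mul c).deriv, fun c : ℝ => ((hFy x y).const_mul c).deriv]
  have hbC : b * C t = 1 - Real.exp (-b * (T - t)) := by
    rw [hC]; field_simp
  have hσC : σ / b * (1 - Real.exp (-b * (T - t))) = σ * C t := by
    rw [hC]; ring
  linear_combination F t x y * x * hbC
    - F t x y * y * p * Real.exp (-(p + q) * t) * hσC
end
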